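/- arXiv:0805.3200 — 2 statements merged into one kernel-verified Lean document; each statement's English description precedes it below -/
import Mathlib

section
/- (Tightness condition.) For A ⊆ M with |A| ≥ 2, the equality R_CO(A) = h(M) − I(A) (i.e. C_SK(A) = I(A)) holds if and only if there exist k with 2 ≤ k ≤ |A|, a partitioning (C_1,…,C_k) ∈ 𝒫_k(A), and a rate tuple R ∈ ℛ(A) such that ∑_{j∈C_i^c} R_j = h(C_i^c) for every i ∈ {1,…,k}. -/
open Finset

/-- Marginal pmf of `p` on the coordinates in `S`. -/
noncomputable def marg {m : ℕ} {𝒳 : Fin m → Type} [∀ i, Fintype (𝒳 i)]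
    [∀ i, DecidableEq (𝒳 i)] (p : (∀ i, 𝒳 i) → ℝ) (S : Finset (Fin m))
    (y : ∀ i : {j // j ∈ S}, 𝒳 i.1) : ℝ :=
  ∑ x : ∀ i, 𝒳 i, if ∀ i : {j // j ∈ S}, x i.1 = y i then p x else 0

/-- Shannon entropy (base 2) of the coordinates in `S`. -/
noncomputable def Hent {m : ℕ} {𝒳 : Fin m → Type} [∀ i, Fintype (𝒳 i)]
    [∀ i, DecidableEq (𝒳 i)] (p : (∀ i, 𝒳 i) → ℝ) (S : Finset (Fin m)) : ℝ :=
  -∑ y : ∀ i : {j // j ∈ S}, 𝒳 i.1, marg p S y * Real.logb 2 (marg p S y)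

/-- The conditional entropy function `h(B) = H(X_M) - H(X_{Bᶜ}) = H(X_B | X_{Bᶜ})`. -/
noncomputable def condh {m : ℕ} {𝒳 : Fin m → Type} [∀ i, Fintype (𝒳 i)]
    [∀ i, DecidableEq (𝒳 i)] (p : (∀ i, 𝒳 i) → ℝ) (B : Finset (Fin m)) : ℝ :=
  Hent p Finset.univ - Hent p Bᶜ

/-- Conditional entropy `H(X_S | X_U) = H(X_{S ∪ U}) - H(X_U)`. -/
noncomputable def condEnt {m : ℕ} {𝒳 : Fin m → Type} [∀ i, Fintype (𝒳 i)]
    [∀ i, DecidableEq (𝒳 i)] (p : (∀ i, 𝒳 i) → ℝ) (S U : Finset (Fin m)) : ℝ :=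
  Hent p (S ∪ U) - Hent p U

/-- `B ∈ ℬ(A)`: `B` is a nonempty proper subset of `M` not containing `A`. -/
def memB {m : ℕ} (A B : Finset (Fin m)) : Prop :=
  B.Nonempty ∧ B ⊂ Finset.univ ∧ ¬ A ⊆ B

/-- `R ∈ ℛ(A)`: the rate tuple `R` satisfies all Slepian–Wolf constraints for `A`. -/
def feasible {m : ℕ} {𝒳 : Fin m → Type} [∀ i, Fintype (𝒳 i)]
    [∀ i, DecidableEq (𝒳 i)] (p : (∀ i, 𝒳 i) → ℝ) (A : Finset (Fin m))
    (R : Fin m → ℝ) : Prop :=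
  ∀ B : Finset (Fin m), memB A B → condh p B ≤ ∑ j ∈ B, R j

/-- Smallest rate of communication for omniscience `R_CO(A)`. -/
noncomputable def RCO {m : ℕ} {𝒳 : Fin m → Type} [∀ i, Fintype (𝒳 i)]
    [∀ i, DecidableEq (𝒳 i)] (p : (∀ i, 𝒳 i) → ℝ) (A : Finset (Fin m)) : ℝ :=
  sInf {s : ℝ | ∃ R : Fin m → ℝ, feasible p A R ∧ s = ∑ j, R j}

/-- `(C 1, …, C k)` is a partition of `M` into pairwise disjoint sets. -/
def isPartition {m k : ℕ} (C : Fin k → Finset (Fin m)) : Prop :=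
  (∀ i j, i ≠ j → Disjoint (C i) (C j)) ∧ Finset.univ.biUnion C = Finset.univ

/-- Mutual dependence `I(C_1,…,C_k)` of the partitioning `C`. -/
noncomputable def Ival {m : ℕ} {𝒳 : Fin m → Type} [∀ i, Fintype (𝒳 i)]
    [∀ i, DecidableEq (𝒳 i)] (p : (∀ i, 𝒳 i) → ℝ) {k : ℕ}
    (C : Fin k → Finset (Fin m)) : ℝ :=
  ((∑ i, Hent p (C i)) - Hent p Finset.univ) / ((k : ℝ) - 1)

/-- Mutual dependence upper bound `I(A)`: minimum of `I(C_1,…,C_k)` over all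
`2 ≤ k ≤ |A|` and partitionings in `𝒫_k(A)`. -/
noncomputable def IA {m : ℕ} {𝒳 : Fin m → Type} [∀ i, Fintype (𝒳 i)]
    [∀ i, DecidableEq (𝒳 i)] (p : (∀ i, 𝒳 i) → ℝ) (A : Finset (Fin m)) : ℝ :=
  sInf {r : ℝ | ∃ k : ℕ, 2 ≤ k ∧ k ≤ A.card ∧ ∃ C : Fin k → Finset (Fin m),
    isPartition C ∧ (∀ i, (C i ∩ A).Nonempty) ∧ r = Ival p C}

/-- Summing a rate tuple over the complements of the cells of a `k`-partition counts every
coordinate `k - 1` times. -/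
theorem sum_compl_of_isPartition {m k : ℕ} {C : Fin k → Finset (Fin m)} (hC : isPartition C)
    (R : Fin m → ℝ) : ∑ i, ∑ j ∈ (C i)ᶜ, R j = ((k : ℝ) - 1) * ∑ j, R j := by
  have h1 : ∑ i, ∑ j ∈ C i, R j = ∑ j, R j := by
    rw [← hC.2, Finset.sum_biUnion fun i _ j _ hij => hC.1 i j hij]
  have h2 : ∀ i, ∑ j ∈ (C i)ᶜ, R j = ∑ j, R j - ∑ j ∈ C i, R j := fun i => by
    rw [← Finset.sum_add_sum_compl (C i) R]; ring
  simp only [h2, Finset.sum_sub_distrib, h1, Finset.sum_const, Finset.card_univ,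
    Fintype.card_fin, nsmul_eq_mul]
  ring

theorem sum_condh_compl {m : ℕ} {𝒳 : Fin m → Type} [∀ i, Fintype (𝒳 i)]
    [∀ i, DecidableEq (𝒳 i)] (p : (∀ i, 𝒳 i) → ℝ) {k : ℕ} (hk : 2 ≤ k)
    (C : Fin k → Finset (Fin m)) :
    ∑ i, condh p (C i)ᶜ = ((k : ℝ) - 1) * (Hent p Finset.univ - Ival p C) := by
  have hk' : (k : ℝ) - 1 ≠ 0 := by
    have : (2 : ℝ) ≤ k := by exact_mod_cast hk
    linarith
  rw [mul_sub, Ival, mul_div_cancel₀ _ hk']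
  simp only [condh, compl_compl, Finset.sum_sub_distrib, Finset.sum_const, Finset.card_univ,
    Fintype.card_fin, nsmul_eq_mul]
  ring

theorem memB_compl_of_isPartition {m k : ℕ} (hk : 2 ≤ k) {A : Finset (Fin m)}
    {C : Fin k → Finset (Fin m)} (hC : isPartition C) (hCA : ∀ i, (C i ∩ A).Nonempty)
    (i : Fin k) : memB A (C i)ᶜ := by
  have : Nontrivial (Fin k) := Fin.nontrivial_iff_two_le.2 hk
  obtain ⟨x, hx⟩ := hCA i
  obtain ⟨j, hj⟩ := exists_ne i
  obtain ⟨y, hy⟩ := hCA j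
  rw [Finset.mem_inter] at hx hy
  have hxc : x ∉ (C i)ᶜ := by simpa using hx.1
  refine ⟨⟨y, Finset.mem_compl.2 fun h => ?_⟩, ?_, fun h => hxc (h hx.2)⟩
  · exact Finset.disjoint_left.1 (hC.1 j i hj) hy.1 h
  · exact Finset.ssubset_univ_iff.2 fun h => hxc (h ▸ Finset.mem_univ x)

theorem sub_Ival_le_sum_of_feasible {m : ℕ} {𝒳 : Fin m → Type} [∀ i, Fintype (𝒳 i)]
    [∀ i, DecidableEq (𝒳 i)] {p : (∀ i, 𝒳 i) → ℝ} {A : Finset (Fin m)}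
    {R : Fin m → ℝ} (hR : feasible p A R) {k : ℕ} (hk : 2 ≤ k) {C : Fin k → Finset (Fin m)}
    (hC : isPartition C) (hCA : ∀ i, (C i ∩ A).Nonempty) :
    Hent p Finset.univ - Ival p C ≤ ∑ j, R j := by
  have hk' : (0 : ℝ) < k - 1 := by
    have : (2 : ℝ) ≤ k := by exact_mod_cast hk
    linarith
  refine le_of_mul_le_mul_left ?_ hk'
  rw [← sum_condh_compl p hk, ← sum_compl_of_isPartition hC]
  exact Finset.sum_le_sum fun i _ => hR _ (memB_compl_of_isPartition hk hC hCA i)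

/-- For a feasible rate tuple, the bound `H(X_M) - I(C_1,…,C_k) ≤ ∑ R_j` is an equality exactly
when all the constraints at the complements of the cells are tight. -/
theorem sum_eq_sub_Ival_iff {m : ℕ} {𝒳 : Fin m → Type} [∀ i, Fintype (𝒳 i)]
    [∀ i, DecidableEq (𝒳 i)] {p : (∀ i, 𝒳 i) → ℝ} {A : Finset (Fin m)}
    {R : Fin m → ℝ} (hR : feasible p A R) {k : ℕ} (hk : 2 ≤ k) {C : Fin k → Finset (Fin m)}
    (hC : isPartition C) (hCA : ∀ i, (C i ∩ A).Nonempty) :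
    ∑ j, R j = Hent p Finset.univ - Ival p C ↔
      ∀ i, ∑ j ∈ (C i)ᶜ, R j = condh p (C i)ᶜ := by
  have hk' : (k : ℝ) - 1 ≠ 0 := by
    have : (2 : ℝ) ≤ k := by exact_mod_cast hk
    linarith
  have hle : ∀ i ∈ Finset.univ, condh p (C i)ᶜ ≤ ∑ j ∈ (C i)ᶜ, R j :=
    fun i _ => hR _ (memB_compl_of_isPartition hk hC hCA i)
  rw [← mul_right_inj' hk', ← sum_compl_of_isPartition hC, ← sum_condh_compl p hk, eq_comm,
    Finset.sum_eq_sum_iff_of_le hle]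
  simp only [Finset.mem_univ, true_imp_iff, eq_comm]

theorem exists_feasible {m : ℕ} {𝒳 : Fin m → Type} [∀ i, Fintype (𝒳 i)]
    [∀ i, DecidableEq (𝒳 i)] (p : (∀ i, 𝒳 i) → ℝ) (A : Finset (Fin m)) :
    ∃ R : Fin m → ℝ, feasible p A R := by
  obtain ⟨c, hc⟩ := (Set.finite_range (condh p)).bddAbove
  refine ⟨fun _ => max c 0, fun B hB => ?_⟩
  have h1 : (1 : ℝ) ≤ B.card := by exact_mod_cast hB.1.card_pos
  rw [Finset.sum_const, nsmul_eq_mul]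
  calc condh p B ≤ max c 0 := (hc ⟨B, rfl⟩).trans (le_max_left _ _)
    _ ≤ B.card * max c 0 := le_mul_of_one_le_left (le_max_right _ _) h1

theorem isClosed_setOf_feasible {m : ℕ} {𝒳 : Fin m → Type} [∀ i, Fintype (𝒳 i)]
    [∀ i, DecidableEq (𝒳 i)] (p : (∀ i, 𝒳 i) → ℝ) (A : Finset (Fin m)) :
    IsClosed {R : Fin m → ℝ | feasible p A R} := by
  simp only [feasible, Set.ofPred_forall]
  exact isClosed_iInter fun B => isClosed_iInter fun _ =>
    isClosed_le continuous_const (by fun_prop)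

theorem condh_singleton_le_of_feasible {m : ℕ} {𝒳 : Fin m → Type} [∀ i, Fintype (𝒳 i)]
    [∀ i, DecidableEq (𝒳 i)] {p : (∀ i, 𝒳 i) → ℝ} {A : Finset (Fin m)}
    (hA : 2 ≤ A.card) {R : Fin m → ℝ} (hR : feasible p A R) (j : Fin m) :
    condh p {j} ≤ R j := by
  have hsub : ¬ A ⊆ {j} := fun h => by
    have := Finset.card_le_card h
    rw [Finset.card_singleton] at this
    omega
  simpa using hR {j} ⟨Finset.singleton_nonempty j,
    Finset.ssubset_univ_iff.2 fun h => hsub (h ▸ Finset.subset_univ A), hsub⟩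

/-- The infimum defining `RCO` is attained. -/
theorem exists_feasible_isLeast {m : ℕ} {𝒳 : Fin m → Type} [∀ i, Fintype (𝒳 i)]
    [∀ i, DecidableEq (𝒳 i)] (p : (∀ i, 𝒳 i) → ℝ) {A : Finset (Fin m)}
    (hA : 2 ≤ A.card) :
    ∃ R : Fin m → ℝ, feasible p A R ∧ ∀ R', feasible p A R' → ∑ j, R j ≤ ∑ j, R' j := by
  obtain ⟨R₀, hR₀⟩ := exists_feasible p A
  let K : Set (Fin m → ℝ) := {R | feasible p A R} ∩ {R | ∑ j, R j ≤ ∑ j, R₀ j}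
  have hclosed : IsClosed K :=
    (isClosed_setOf_feasible p A).inter (isClosed_le (by fun_prop) continuous_const)
  have hsub : K ⊆ Set.Icc (fun j => condh p {j})
      (fun j => ∑ i, R₀ i - ∑ i ∈ Finset.univ.erase j, condh p {i}) := by
    rintro R ⟨hR, hle⟩
    refine ⟨fun j => condh_singleton_le_of_feasible hA hR j, fun j => ?_⟩
    have h1 : ∑ i ∈ Finset.univ.erase j, condh p {i} ≤ ∑ i ∈ Finset.univ.erase j, R i :=
      Finset.sum_le_sum fun i _ => condh_singleton_le_of_feasible hA hR i
    have h2 := Finset.add_sum_erase Finset.univ R (Finset.mem_univ j)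
    have h3 : ∑ i, R i ≤ ∑ i, R₀ i := hle
    change R j ≤ _
    linarith
  obtain ⟨R, hRK, hmin⟩ := (isCompact_Icc.of_isClosed_subset hclosed hsub).exists_isMinOn
    ⟨R₀, hR₀, le_refl (∑ j, R₀ j)⟩
    (f := fun R : Fin m → ℝ => ∑ j, R j) (by fun_prop)
  refine ⟨R, hRK.1, fun R' hR' => ?_⟩
  rcases le_total (∑ j, R' j) (∑ j, R₀ j) with h | h
  · exact hmin ⟨hR', h⟩
  · exact le_trans hRK.2 h

theorem RCO_eq_of_isLeast {m : ℕ} {𝒳 : Fin m → Type} [∀ i, Fintype (𝒳 i)]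
    [∀ i, DecidableEq (𝒳 i)] {p : (∀ i, 𝒳 i) → ℝ} {A : Finset (Fin m)}
    {R : Fin m → ℝ} (hR : feasible p A R)
    (hmin : ∀ R', feasible p A R' → ∑ j, R j ≤ ∑ j, R' j) : RCO p A = ∑ j, R j :=
  IsLeast.csInf_eq ⟨⟨R, hR, rfl⟩, by rintro _ ⟨R', hR', rfl⟩; exact hmin R' hR'⟩

/-- The set of values `I(C_1,…,C_k)` attains its infimum `IA`. -/
theorem isLeast_IA {m : ℕ} {𝒳 : Fin m → Type} [∀ i, Fintype (𝒳 i)]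
    [∀ i, DecidableEq (𝒳 i)] (p : (∀ i, 𝒳 i) → ℝ) {A : Finset (Fin m)} (hA : 2 ≤ A.card) :
    IsLeast {r : ℝ | ∃ k : ℕ, 2 ≤ k ∧ k ≤ A.card ∧ ∃ C : Fin k → Finset (Fin m),
      isPartition C ∧ (∀ i, (C i ∩ A).Nonempty) ∧ r = Ival p C} (IA p A) := by
  have hfin : {r : ℝ | ∃ k : ℕ, 2 ≤ k ∧ k ≤ A.card ∧ ∃ C : Fin k → Finset (Fin m),
      isPartition C ∧ (∀ i, (C i ∩ A).Nonempty) ∧ r = Ival p C}.Finite := by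
    refine ((Set.finite_Iic A.card).biUnion fun k _ =>
      Set.finite_range fun C : Fin k → Finset (Fin m) => Ival p C).subset ?_
    rintro r ⟨k, -, hk, C, -, -, rfl⟩
    exact Set.mem_biUnion hk ⟨C, rfl⟩
  refine ⟨Set.Nonempty.csInf_mem ?_ hfin, fun r hr => csInf_le hfin.bddBelow hr⟩
  obtain ⟨a, ha, b, hb, hab⟩ := Finset.one_lt_card.1 hA
  refine ⟨_, 2, le_rfl, hA, ![{a}, {a}ᶜ], ⟨?_, ?_⟩, ?_, rfl⟩
  · simp [Fin.forall_fin_two]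
  · ext x
    simp [em]
  · rw [Fin.forall_fin_two]
    exact ⟨⟨a, by simp [ha]⟩, ⟨b, by simp [hb, hab.symm]⟩⟩

/-- **Tightness condition.** `C_SK(A) = I(A)` (i.e. `R_CO(A) = h(M) − I(A)`) iff there
exist `2 ≤ k ≤ |A|`, a partitioning `(C_1,…,C_k) ∈ 𝒫_k(A)` and `R ∈ ℛ(A)` such that
the Slepian–Wolf constraints at all complements `C_iᶜ` are tight. -/
theorem tightness_condition {m : ℕ} (hm : 2 ≤ m) {𝒳 : Fin m → Type}
    [∀ i, Fintype (𝒳 i)] [∀ i, DecidableEq (𝒳 i)] [∀ i, Nonempty (𝒳 i)]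
    (p : (∀ i, 𝒳 i) → ℝ) (hp0 : ∀ x, 0 ≤ p x) (hp1 : ∑ x, p x = 1)
    (A : Finset (Fin m)) (hA : 2 ≤ A.card) :
    RCO p A = Hent p Finset.univ - IA p A ↔
      ∃ k : ℕ, 2 ≤ k ∧ k ≤ A.card ∧ ∃ C : Fin k → Finset (Fin m),
        isPartition C ∧ (∀ i, (C i ∩ A).Nonempty) ∧
        ∃ R : Fin m → ℝ, feasible p A R ∧
          ∀ i, ∑ j ∈ (C i)ᶜ, R j = condh p (C i)ᶜ := by
  obtain ⟨R₀, hR₀, hmin⟩ := exists_feasible_isLeast p hA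
  obtain ⟨⟨k₀, hk₀, hk₀A, C₀, hC₀, hC₀A, hI⟩, hlow⟩ := isLeast_IA p hA
  rw [RCO_eq_of_isLeast hR₀ hmin]
  constructor
  · intro h
    rw [hI] at h
    exact ⟨k₀, hk₀, hk₀A, C₀, hC₀, hC₀A, R₀, hR₀,
      (sum_eq_sub_Ival_iff hR₀ hk₀ hC₀ hC₀A).1 h⟩
  · rintro ⟨k, hk, hkA, C, hC, hCA, R, hR, htight⟩
    have h1 := (sum_eq_sub_Ival_iff hR hk hC hCA).2 htight
    have h2 := sub_Ival_le_sum_of_feasible hR₀ hk₀ hC₀ hC₀A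
    have h3 := hlow ⟨k, hk, hkA, C, hC, hCA, rfl⟩
    have h4 := hmin R hR
    linarith
end

section
/- For the XOR counter-example source with active set A = {1, 2, 3}: the rate tuple R = (1/4, 1/4, 1/4, 1/2, 1/2, 1/2) belongs to ℛ(A), and the smallest rate of communication for omniscience is R_CO(A) = 9/4 (so R attains the minimum). -/
open Finset

/-- The XOR map defining the counter-example source: `X_1 = Y_1 ⊕ Y_3`,
`X_2 = Y_1 ⊕ Y_4`, `X_3 = Y_3 ⊕ Y_4`, `X_4 = Y_2 ⊕ Y_3`, `X_5 = Y_2 ⊕ Y_4`,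
`X_6 = Y_1 ⊕ Y_2` (indices shifted to start from `0`). -/
def xorMap (y : Fin 4 → ZMod 2) : Fin 6 → ZMod 2 :=
  ![y 0 + y 2, y 0 + y 3, y 2 + y 3, y 1 + y 2, y 1 + y 3, y 0 + y 1]

/-- The joint pmf of the counter-example source: the pushforward under `xorMap`
of the uniform distribution on `𝔽₂⁴`. -/
noncomputable def xorP (x : Fin 6 → ZMod 2) : ℝ :=
  ((Finset.univ.filter (fun y : Fin 4 → ZMod 2 => xorMap y = x)).card : ℝ) / 16

/-- The number of source words `w` whose image under `xorMap` vanishes on `S`. -/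
def xorKerCard (S : Finset (Fin 6)) : ℕ :=
  (univ.filter fun w : Fin 4 → ZMod 2 => ∀ i ∈ S, xorMap w i = 0).card

lemma xorMap_sub (v w : Fin 4 → ZMod 2) : xorMap (v - w) = xorMap v - xorMap w := by
  ext i
  fin_cases i <;> simp [xorMap] <;> ring

lemma xorKerCard_pos (S : Finset (Fin 6)) : 0 < xorKerCard S := by
  refine card_pos.mpr ⟨0, ?_⟩
  simp only [mem_filter, mem_univ, true_and]
  intro i _
  simpa using congrFun (xorMap_sub 0 0) i

lemma marg_xorP (S : Finset (Fin 6)) (y : {j // j ∈ S} → ZMod 2) :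
    marg xorP S y =
      ((univ.filter fun w => ∀ i : {j // j ∈ S}, xorMap w i.1 = y i).card : ℝ) / 16 := by
  simp only [marg, xorP]
  rw [← sum_filter, ← sum_div, ← Nat.cast_sum, sum_card_fiberwise_eq_card_filter]
  simp only [mem_filter, mem_univ, true_and]

/-- Each fibre of a coordinate projection of `xorMap` is empty or a coset of the kernel. -/
lemma card_fiber_xorMap (S : Finset (Fin 6)) (y : {j // j ∈ S} → ZMod 2) :
    (univ.filter fun w => ∀ i : {j // j ∈ S}, xorMap w i.1 = y i).card = 0 ∨
      (univ.filter fun w => ∀ i : {j // j ∈ S}, xorMap w i.1 = y i).card = xorKerCard S := by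
  rcases (univ.filter fun w => ∀ i : {j // j ∈ S}, xorMap w i.1 = y i).eq_empty_or_nonempty
    with h | ⟨v, hv⟩
  · exact Or.inl (by rw [h, card_empty])
  · right
    simp only [mem_filter, mem_univ, true_and] at hv
    refine card_equiv (Equiv.subRight v) fun w => ?_
    simp only [mem_filter, mem_univ, true_and, Equiv.subRight_apply, xorMap_sub, Pi.sub_apply,
      sub_eq_zero, Subtype.forall]
    exact forall₂_congr fun i hi => by rw [hv ⟨i, hi⟩]

lemma sum_card_fiber_xorMap (S : Finset (Fin 6)) :
    ∑ y : {j // j ∈ S} → ZMod 2,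
      (univ.filter fun w => ∀ i : {j // j ∈ S}, xorMap w i.1 = y i).card = 16 := by
  have h := card_eq_sum_card_fiberwise (s := (univ : Finset (Fin 4 → ZMod 2)))
    (t := (univ : Finset ({j // j ∈ S} → ZMod 2)))
    (f := fun w i => xorMap w i.1) (fun _ _ => mem_coe.mpr (mem_univ _))
  simp only [funext_iff] at h
  rw [← h]
  simp [ZMod.card]

lemma Hent_xorP (S : Finset (Fin 6)) :
    Hent xorP S = 4 - Real.logb 2 (xorKerCard S) := by
  have hK : (xorKerCard S : ℝ) ≠ 0 := by exact_mod_cast (xorKerCard_pos S).ne'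
  have hterm (y : {j // j ∈ S} → ZMod 2) :
      marg xorP S y * Real.logb 2 (marg xorP S y) =
        ((univ.filter fun w => ∀ i : {j // j ∈ S}, xorMap w i.1 = y i).card : ℝ) *
          (Real.logb 2 (xorKerCard S / 16) / 16) := by
    rw [marg_xorP]
    rcases card_fiber_xorMap S y with h | h
    · rw [h]
      simp
    · rw [h]
      ring
  have h16 : Real.logb 2 16 = 4 := by
    rw [show (16 : ℝ) = 2 ^ (4 : ℕ) by norm_num, Real.logb_pow]
    simp
  rw [Hent, sum_congr rfl fun y _ => hterm y, ← sum_mul, ← Nat.cast_sum, sum_card_fiber_xorMap,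
    Real.logb_div hK (by norm_num), h16]
  push_cast
  ring

lemma xorKerCard_univ : xorKerCard univ = 2 := by decide +kernel

lemma condh_xorP (B : Finset (Fin 6)) :
    condh xorP B = Real.logb 2 (xorKerCard Bᶜ) - 1 := by
  rw [condh, Hent_xorP, Hent_xorP, xorKerCard_univ]
  simp

lemma condh_xorP_le {B : Finset (Fin 6)} {k : ℕ} (h : xorKerCard Bᶜ ≤ 2 ^ (k + 1)) :
    condh xorP B ≤ k := by
  have hpos : (0 : ℝ) < xorKerCard Bᶜ := by exact_mod_cast xorKerCard_pos Bᶜ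
  have := Real.logb_le_logb_of_le one_lt_two hpos
    (show (xorKerCard Bᶜ : ℝ) ≤ 2 ^ (k + 1) by exact_mod_cast h)
  rw [Real.logb_pow, Real.logb_self_eq_one one_lt_two] at this
  rw [condh_xorP]
  push_cast at this
  linarith

lemma condh_xorP_eq {B : Finset (Fin 6)} {k : ℕ} (h : xorKerCard Bᶜ = 2 ^ (k + 1)) :
    condh xorP B = k := by
  rw [condh_xorP, h, Nat.cast_pow, Real.logb_pow]
  simp

lemma xorKerCard_compl_le_of_not_subset (B : Finset (Fin 6)) (hB : ¬ ({0, 1, 2} : Finset _) ⊆ B) :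
    ∃ k < 3, xorKerCard Bᶜ ≤ 2 ^ (k + 1) ∧ 4 * k ≤ ∑ j ∈ B, ![1, 1, 1, 2, 2, 2] j := by
  revert B
  decide +kernel

lemma feasible_xorP :
    feasible xorP ({0, 1, 2} : Finset (Fin 6)) ![1/4, 1/4, 1/4, 1/2, 1/2, 1/2] := by
  intro B hB
  obtain ⟨k, -, hk, hsum⟩ := xorKerCard_compl_le_of_not_subset B hB.2.2
  refine (condh_xorP_le hk).trans ?_
  have hw (j : Fin 6) : (![1/4, 1/4, 1/4, 1/2, 1/2, 1/2] : Fin 6 → ℝ) j =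
      ((![1, 1, 1, 2, 2, 2] : Fin 6 → ℕ) j : ℝ) / 4 := by
    fin_cases j <;> norm_num
  rw [sum_congr rfl fun j _ => hw j, ← sum_div, ← Nat.cast_sum, le_div_iff₀ (by norm_num)]
  exact_mod_cast (mul_comm k 4).trans_le hsum

lemma le_sum_of_feasible_xorP {R : Fin 6 → ℝ}
    (hR : feasible xorP ({0, 1, 2} : Finset (Fin 6)) R) : 9 / 4 ≤ ∑ j, R j := by
  have bound (B : Finset (Fin 6)) (k : ℕ) (hk : xorKerCard Bᶜ = 2 ^ (k + 1))
      (hB : B.Nonempty ∧ B ⊂ univ ∧ ¬ ({0, 1, 2} : Finset (Fin 6)) ⊆ B) :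
      (k : ℝ) ≤ ∑ j ∈ B, R j :=
    (condh_xorP_eq hk).symm.trans_le (hR B hB)
  have h₀ := bound {1, 2, 3, 4, 5} 2 (by decide +kernel) (by decide +kernel)
  have h₁ := bound {0, 2, 3, 4, 5} 2 (by decide +kernel) (by decide +kernel)
  have h₂ := bound {0, 1, 3, 4, 5} 2 (by decide +kernel) (by decide +kernel)
  have h₃ := bound {0, 1, 5} 1 (by decide +kernel) (by decide +kernel)
  have h₄ := bound {0, 2, 3} 1 (by decide +kernel) (by decide +kernel)
  have h₅ := bound {1, 2, 4} 1 (by decide +kernel) (by decide +kernel)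
  simp at h₀ h₁ h₂ h₃ h₄ h₅
  simp only [Fin.sum_univ_six]
  linarith

/-- For the XOR counter-example with active set `A = {1,2,3}` (here `{0,1,2}`),
the rate tuple `(1/4, 1/4, 1/4, 1/2, 1/2, 1/2)` is in `ℛ(A)` and
`R_CO(A) = 9/4`. -/
theorem xor_RCO_value :
    feasible xorP ({0, 1, 2} : Finset (Fin 6))
      ![1/4, 1/4, 1/4, 1/2, 1/2, 1/2] ∧
    RCO xorP ({0, 1, 2} : Finset (Fin 6)) = 9/4 := by
  refine ⟨feasible_xorP, IsLeast.csInf_eq ⟨⟨_, feasible_xorP, ?_⟩, ?_⟩⟩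
  · simp [Fin.sum_univ_succ]
    norm_num
  · rintro s ⟨R, hR, rfl⟩
    exact le_sum_of_feasible_xorP hR
end
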